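/- arXiv:2203.14734 — 2 statements merged into one kernel-verified Lean document; each statement's English description precedes it below -/
import Mathlib

section
/- There exists a constant A = A(n) > 0 with the following property: let R > 1 and 0 < T ≤ R, and let u be a smooth solution of the biharmonic heat equation on ℝⁿ × [0,T] such that sup_{t ∈ [0,T]} ∫_{ℝⁿ} u(x,t)² dx < ∞ and u(·,0) is supported in B(0,R). Then ∫_{ℝⁿ ∖ B(0,2R)} u(x,T/2)² dx ≤ exp( − R^{4/3} / (2 A T^{1/3}) ) · ∫_{B(0,R)} u(x,0)² dx. -/
open MeasureTheory Metric Set Filter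

/-- The Euclidean Laplacian `Δf = ∑ᵢ ∂²f/∂xᵢ²`. -/
noncomputable def lap {n : ℕ} (f : EuclideanSpace ℝ (Fin n) → ℝ) :
    EuclideanSpace ℝ (Fin n) → ℝ :=
  fun x => ∑ i : Fin n,
    fderiv ℝ (fun y => fderiv ℝ f y (EuclideanSpace.single i 1)) x (EuclideanSpace.single i 1)

/-- `u = u(x,t)` is a smooth solution of the biharmonic heat equation
`∂ₜu = -Δ²u` on the set `S ⊆ ℝⁿ × ℝ`. -/
def IsBiharmonicHeatSol {n : ℕ} (u : EuclideanSpace ℝ (Fin n) → ℝ → ℝ)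
    (S : Set (EuclideanSpace ℝ (Fin n) × ℝ)) : Prop :=
  ContDiffOn ℝ (⊤ : ℕ∞) (fun p => u p.1 p.2) S ∧
  ∀ p ∈ S, HasDerivWithinAt (fun s => u p.1 s)
    (-(lap (lap (fun y => u y p.2)) p.1)) {s | (p.1, s) ∈ S} p.2

open scoped ContDiff Topology

/-- The `i`-th partial derivative of a function on Euclidean space. -/
noncomputable def partialDeriv {n : ℕ} (i : Fin n) (f : EuclideanSpace ℝ (Fin n) → ℝ) :
    EuclideanSpace ℝ (Fin n) → ℝ :=
  fun x => fderiv ℝ f x (EuclideanSpace.single i 1)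

section Calculus

variable {n : ℕ} {f g : EuclideanSpace ℝ (Fin n) → ℝ}

theorem lap_eq_sum (f : EuclideanSpace ℝ (Fin n) → ℝ) (x : EuclideanSpace ℝ (Fin n)) :
    lap f x = ∑ i, partialDeriv i (partialDeriv i f) x := rfl

theorem ContDiff.partialDeriv (hf : ContDiff ℝ ∞ f) (i : Fin n) :
    ContDiff ℝ ∞ (partialDeriv i f) :=
  (hf.fderiv_right (by simp)).clm_apply contDiff_const

theorem ContDiff.lap (hf : ContDiff ℝ ∞ f) : ContDiff ℝ ∞ (lap f) :=
  ContDiff.sum fun i _ => (hf.partialDeriv i).partialDeriv i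

theorem HasCompactSupport.partialDeriv (hf : HasCompactSupport f) (i : Fin n) :
    HasCompactSupport (partialDeriv i f) :=
  hf.fderiv_apply ℝ _

theorem HasCompactSupport.lap (hf : HasCompactSupport f) : HasCompactSupport (lap f) := by
  refine HasCompactSupport.intro hf.isCompact fun x hx => ?_
  rw [lap_eq_sum]
  refine Finset.sum_eq_zero fun i _ => image_eq_zero_of_notMem_tsupport fun h => hx ?_
  exact (tsupport_fderiv_apply_subset ℝ _).trans (tsupport_fderiv_apply_subset ℝ _) h

theorem partialDeriv_mul (hf : ContDiff ℝ ∞ f) (hg : ContDiff ℝ ∞ g) (i : Fin n) :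
    partialDeriv i (fun x => f x * g x) =
      fun x => partialDeriv i f x * g x + f x * partialDeriv i g x := by
  ext x
  have h := ((hf.differentiable (by simp)).differentiableAt (x := x)).hasFDerivAt.mul
    ((hg.differentiable (by simp)).differentiableAt (x := x)).hasFDerivAt
  unfold partialDeriv
  rw [show (fun x => f x * g x) = f * g from rfl, h.fderiv]
  simp
  ring

theorem partialDeriv_add (hf : ContDiff ℝ ∞ f) (hg : ContDiff ℝ ∞ g) (i : Fin n)
    (x : EuclideanSpace ℝ (Fin n)) :
    partialDeriv i (fun x => f x + g x) x = partialDeriv i f x + partialDeriv i g x := by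
  unfold partialDeriv
  rw [fderiv_fun_add ((hf.differentiable (by simp)).differentiableAt)
    ((hg.differentiable (by simp)).differentiableAt)]
  rfl

theorem lap_mul (hf : ContDiff ℝ ∞ f) (hg : ContDiff ℝ ∞ g) (x : EuclideanSpace ℝ (Fin n)) :
    lap (fun x => f x * g x) x =
      lap f x * g x + 2 * ∑ i, partialDeriv i f x * partialDeriv i g x + f x * lap g x := by
  simp only [lap_eq_sum, Finset.sum_mul, Finset.mul_sum, ← Finset.sum_add_distrib]
  refine Finset.sum_congr rfl fun i _ => ?_
  rw [partialDeriv_mul hf hg, partialDeriv_add ((hf.partialDeriv i).mul hg)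
    (hf.mul (hg.partialDeriv i)), partialDeriv_mul (hf.partialDeriv i) hg,
    partialDeriv_mul hf (hg.partialDeriv i)]
  ring

theorem integral_mul_partialDeriv (hf : ContDiff ℝ ∞ f) (hg : ContDiff ℝ ∞ g)
    (hc : HasCompactSupport f) (i : Fin n) :
    ∫ x, f x * partialDeriv i g x = -∫ x, partialDeriv i f x * g x := by
  refine integral_mul_fderiv_eq_neg_fderiv_mul_of_integrable ?_ ?_ ?_
    (fun x _ => (hf.differentiable (by simp)).differentiableAt)
    (fun x _ => (hg.differentiable (by simp)).differentiableAt)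
  · exact ((hf.partialDeriv i).continuous.mul hg.continuous).integrable_of_hasCompactSupport
      ((hc.partialDeriv i).mul_right)
  · exact (hf.continuous.mul (hg.partialDeriv i).continuous).integrable_of_hasCompactSupport
      hc.mul_right
  · exact (hf.continuous.mul hg.continuous).integrable_of_hasCompactSupport hc.mul_right

/-- Green's second identity, without boundary terms. -/
theorem integral_mul_lap (hf : ContDiff ℝ ∞ f) (hg : ContDiff ℝ ∞ g)
    (hc : HasCompactSupport f) : ∫ x, f x * lap g x = ∫ x, lap f x * g x := by
  simp only [lap_eq_sum, Finset.mul_sum, Finset.sum_mul]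
  rw [integral_finsetSum, integral_finsetSum]
  · refine Finset.sum_congr rfl fun i _ => ?_
    rw [integral_mul_partialDeriv hf (hg.partialDeriv i) hc,
      integral_mul_partialDeriv (hf.partialDeriv i) hg (hc.partialDeriv i), neg_neg]
  · intro i _
    exact (((hf.partialDeriv i).partialDeriv i).continuous.mul
      hg.continuous).integrable_of_hasCompactSupport
      ((hc.partialDeriv i).partialDeriv i).mul_right
  · intro i _
    exact (hf.continuous.mul
      ((hg.partialDeriv i).partialDeriv i).continuous).integrable_of_hasCompactSupport
      hc.mul_right

end Calculus

/-- The pointwise algebraic inequality behind the weighted energy estimate: `u`, `v` stand for the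
values of a function and of its Laplacian, `p` and `g` for the values of the two weights, and
`a`, `b`, `c` for the gradients of `u`, `p`, `g`. -/
theorem weighted_energy_pointwise {ι : Type*} [Fintype ι] (a b c : ι → ℝ)
    {u v p g lp lg m : ℝ} (hp : 0 ≤ p) (hpg : p ≤ g)
    (hb : ∑ i, b i ^ 2 ≤ m ^ 2 * g ^ 2) (hc : ∑ i, c i ^ 2 ≤ m ^ 2 * g ^ 2)
    (hlp : |lp| ≤ m ^ 2 * g) (hlg : |lg| ≤ m ^ 2 * g) :
    -(4864 * m ^ 4 * (g ^ 4 * u ^ 2)) ≤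
      v * (v * p ^ 4 + 8 * p ^ 3 * ∑ i, a i * b i
          + u * (4 * p ^ 3 * lp + 12 * p ^ 2 * ∑ i, b i ^ 2))
        + 32 * m ^ 2 * (p ^ 2 * g ^ 2 * (2 * u * v + 2 * ∑ i, a i ^ 2)
          - u ^ 2 * (2 * p * g ^ 2 * lp + 2 * g ^ 2 * ∑ i, b i ^ 2 + 2 * p ^ 2 * g * lg
            + 2 * p ^ 2 * ∑ i, c i ^ 2 + 8 * p * g * ∑ i, b i * c i)) := by
  have hg : 0 ≤ g := hp.trans hpg
  have hab := Finset.sum_mul_sq_le_sq_mul_sq Finset.univ a b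
  have hbc := Finset.sum_mul_sq_le_sq_mul_sq Finset.univ b c
  have ha0 : 0 ≤ ∑ i, a i ^ 2 := Finset.sum_nonneg fun i _ => sq_nonneg _
  have hb0 : 0 ≤ ∑ i, b i ^ 2 := Finset.sum_nonneg fun i _ => sq_nonneg _
  have hc0 : 0 ≤ ∑ i, c i ^ 2 := Finset.sum_nonneg fun i _ => sq_nonneg _
  generalize ∑ i, a i ^ 2 = A at *
  generalize ∑ i, b i ^ 2 = B at *
  generalize ∑ i, c i ^ 2 = C at *
  generalize ∑ i, a i * b i = ab at *
  generalize ∑ i, b i * c i = bc at *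
  have hbc' : |bc| ≤ m ^ 2 * g ^ 2 := by
    refine abs_le_of_sq_le_sq (hbc.trans ?_) (by positivity)
    calc B * C ≤ (m ^ 2 * g ^ 2) * (m ^ 2 * g ^ 2) := by gcongr
      _ = _ := by ring
  have hab' : ab ^ 2 ≤ A * (m ^ 2 * g ^ 2) := hab.trans (by gcongr)
  have h1 : -(p ^ 4 * v ^ 2 / 4 + 64 * m ^ 2 * p ^ 2 * g ^ 2 * A) ≤ v * (8 * p ^ 3 * ab) := by
    have : 0 ≤ (p ^ 2 * v / 2 + 8 * p * ab) ^ 2 := sq_nonneg _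
    have h2 : 64 * p ^ 2 * ab ^ 2 ≤ 64 * p ^ 2 * (A * (m ^ 2 * g ^ 2)) := by gcongr
    nlinarith
  have h2 : |4 * p ^ 3 * lp + 12 * p ^ 2 * B| ≤ 16 * m ^ 2 * p ^ 2 * g ^ 2 := by
    calc |4 * p ^ 3 * lp + 12 * p ^ 2 * B| ≤ |4 * p ^ 3 * lp| + |12 * p ^ 2 * B| := abs_add_le _ _
      _ = 4 * (p ^ 2 * p) * |lp| + 12 * p ^ 2 * B := by
        rw [abs_mul, abs_of_nonneg (by positivity : 0 ≤ 4 * p ^ 3),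
          abs_of_nonneg (by positivity : 0 ≤ 12 * p ^ 2 * B)]; ring
      _ ≤ 4 * (p ^ 2 * g) * (m ^ 2 * g) + 12 * p ^ 2 * (m ^ 2 * g ^ 2) := by gcongr
      _ = _ := by ring
  have h3 : -(p ^ 4 * v ^ 2 / 4 + 256 * m ^ 4 * g ^ 4 * u ^ 2) ≤
      v * (u * (4 * p ^ 3 * lp + 12 * p ^ 2 * B)) := by
    have h4 : |v * (u * (4 * p ^ 3 * lp + 12 * p ^ 2 * B))| ≤
        |v| * (|u| * (16 * m ^ 2 * p ^ 2 * g ^ 2)) := by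
      rw [abs_mul, abs_mul]; gcongr
    have h5 := neg_abs_le (v * (u * (4 * p ^ 3 * lp + 12 * p ^ 2 * B)))
    have h6 : 0 ≤ (p ^ 2 * |v| / 2 - 16 * m ^ 2 * g ^ 2 * |u|) ^ 2 := sq_nonneg _
    have h7 : (p ^ 2 * |v| / 2 - 16 * m ^ 2 * g ^ 2 * |u|) ^ 2 = p ^ 4 * |v| ^ 2 / 4
        + 256 * m ^ 4 * g ^ 4 * |u| ^ 2 - |v| * (|u| * (16 * m ^ 2 * p ^ 2 * g ^ 2)) := by ring
    rw [sq_abs, sq_abs] at h7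
    linarith
  have h4 : -(p ^ 4 * v ^ 2 / 4 + 4096 * m ^ 4 * g ^ 4 * u ^ 2) ≤
      64 * m ^ 2 * p ^ 2 * g ^ 2 * (u * v) := by
    have : 0 ≤ (p ^ 2 * v / 2 + 64 * m ^ 2 * g ^ 2 * u) ^ 2 := sq_nonneg _
    nlinarith
  have h5 : 2 * p * g ^ 2 * lp + 2 * g ^ 2 * B + 2 * p ^ 2 * g * lg
      + 2 * p ^ 2 * C + 8 * p * g * bc ≤ 16 * m ^ 2 * g ^ 4 := by
    calc _ ≤ 2 * p * g ^ 2 * |lp| + 2 * g ^ 2 * B + 2 * p ^ 2 * g * |lg|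
          + 2 * p ^ 2 * C + 8 * p * g * |bc| := by
          gcongr <;> exact le_abs_self _
      _ ≤ 2 * g * g ^ 2 * (m ^ 2 * g) + 2 * g ^ 2 * (m ^ 2 * g ^ 2) + 2 * g ^ 2 * g * (m ^ 2 * g)
          + 2 * g ^ 2 * (m ^ 2 * g ^ 2) + 8 * g * g * (m ^ 2 * g ^ 2) := by gcongr
      _ = _ := by ring
  have h6 : 32 * m ^ 2 * u ^ 2 * (2 * p * g ^ 2 * lp + 2 * g ^ 2 * B + 2 * p ^ 2 * g * lg
      + 2 * p ^ 2 * C + 8 * p * g * bc) ≤ 32 * m ^ 2 * u ^ 2 * (16 * m ^ 2 * g ^ 4) := by gcongr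
  have h7 : 0 ≤ p ^ 4 * v ^ 2 := by positivity
  linarith

section WeightedEnergy

variable {n : ℕ} {u p g : EuclideanSpace ℝ (Fin n) → ℝ} {m : ℝ}

/-- Weighted lower bound for the energy `∫ u Δ²u p⁴`, for an arbitrary smooth function `u` and
weights `0 ≤ p ≤ g` whose first two derivatives are controlled by `g`. -/
theorem integral_mul_lap_lap_ge (hu : ContDiff ℝ ∞ u) (hp : ContDiff ℝ ∞ p)
    (hg : ContDiff ℝ ∞ g) (hpc : HasCompactSupport p) (hp0 : ∀ x, 0 ≤ p x)
    (hpg : ∀ x, p x ≤ g x)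
    (hdp : ∀ x, ∑ i, partialDeriv i p x ^ 2 ≤ m ^ 2 * g x ^ 2)
    (hdg : ∀ x, ∑ i, partialDeriv i g x ^ 2 ≤ m ^ 2 * g x ^ 2)
    (hlp : ∀ x, |lap p x| ≤ m ^ 2 * g x) (hlg : ∀ x, |lap g x| ≤ m ^ 2 * g x)
    (hint : Integrable fun x => g x ^ 4 * u x ^ 2) :
    -(4864 * m ^ 4 * ∫ x, g x ^ 4 * u x ^ 2) ≤ ∫ x, u x * lap (lap u) x * p x ^ 4 := by
  have hp2 := hp.mul hp
  have hg2 := hg.mul hg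
  have hp4 := hp2.mul hp2
  have hh := hp2.mul hg2
  have huu := hu.mul hu
  have hup := hu.mul hp4
  have hhc : HasCompactSupport fun x => (p x * p x) * (g x * g x) := hpc.mul_right.mul_right
  have hupc : HasCompactSupport fun x => u x * ((p x * p x) * (p x * p x)) :=
    (hpc.mul_right.mul_right).mul_left
  have hG1 := integral_mul_lap hup hu.lap hupc
  have hG2 := integral_mul_lap hh huu hhc
  have hI1 : Integrable fun x => lap (fun x => u x * ((p x * p x) * (p x * p x))) x * lap u x :=
    (hup.lap.continuous.mul hu.lap.continuous).integrable_of_hasCompactSupport hupc.lap.mul_right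
  have hI2 : Integrable fun x => (p x * p x) * (g x * g x) * lap (fun x => u x * u x) x :=
    (hh.continuous.mul huu.lap.continuous).integrable_of_hasCompactSupport hhc.mul_right
  have hI3 : Integrable fun x => lap (fun x => (p x * p x) * (g x * g x)) x * (u x * u x) :=
    (hh.lap.continuous.mul huu.continuous).integrable_of_hasCompactSupport hhc.lap.mul_right
  have key : ∫ x, u x * lap (lap u) x * p x ^ 4 =
      ∫ x, (lap (fun x => u x * ((p x * p x) * (p x * p x))) x * lap u x
        + 32 * m ^ 2 * ((p x * p x) * (g x * g x) * lap (fun x => u x * u x) x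
          - lap (fun x => (p x * p x) * (g x * g x)) x * (u x * u x))) := by
    have hI : Integrable fun x => 32 * m ^ 2 * ((p x * p x) * (g x * g x)
        * lap (fun x => u x * u x) x
          - lap (fun x => (p x * p x) * (g x * g x)) x * (u x * u x)) :=
      (hI2.sub hI3).const_mul _
    rw [integral_add hI1 hI, integral_const_mul, integral_sub hI2 hI3,
      hG2, ← hG1, sub_self, mul_zero, add_zero]
    refine integral_congr_ae (.of_forall fun x => ?_)
    simp only
    ring
  rw [key, ← integral_const_mul, ← integral_neg]
  refine integral_mono (hint.const_mul _).neg (hI1.add ((hI2.sub hI3).const_mul _)) fun x => ?_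
  refine (weighted_energy_pointwise (fun i => partialDeriv i u x) (fun i => partialDeriv i p x)
    (fun i => partialDeriv i g x) (u := u x) (v := lap u x) (hp0 x) (hpg x) (hdp x) (hdg x)
    (hlp x) (hlg x)).trans_eq ?_
  simp only [lap_mul hu hp4, lap_mul hp2 hp2, lap_mul hp2 hg2, lap_mul hp hp, lap_mul hg hg,
    lap_mul hu hu, partialDeriv_mul hp2 hp2, partialDeriv_mul hp hp, partialDeriv_mul hg hg]
  have e1 : ∑ i, partialDeriv i u x * ((partialDeriv i p x * p x + p x * partialDeriv i p x)
      * (p x * p x) + p x * p x * (partialDeriv i p x * p x + p x * partialDeriv i p x)) =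
      4 * p x ^ 3 * ∑ i, partialDeriv i u x * partialDeriv i p x := by
    rw [Finset.mul_sum]; exact Finset.sum_congr rfl fun i _ => by ring
  have e2 : ∑ i, (partialDeriv i p x * p x + p x * partialDeriv i p x) *
      (partialDeriv i p x * p x + p x * partialDeriv i p x) =
      4 * p x ^ 2 * ∑ i, partialDeriv i p x ^ 2 := by
    rw [Finset.mul_sum]; exact Finset.sum_congr rfl fun i _ => by ring
  have e3 : ∑ i, (partialDeriv i p x * p x + p x * partialDeriv i p x) *
      (partialDeriv i g x * g x + g x * partialDeriv i g x) =
      4 * p x * g x * ∑ i, partialDeriv i p x * partialDeriv i g x := by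
    rw [Finset.mul_sum]; exact Finset.sum_congr rfl fun i _ => by ring
  rw [e1, e2, e3]
  simp only [← sq]
  ring

end WeightedEnergy
section Weights

variable {n : ℕ} {f g : EuclideanSpace ℝ (Fin n) → ℝ}

theorem partialDeriv_affine_comp_smul (hf : ContDiff ℝ ∞ f) (a b c : ℝ) (i : Fin n) :
    partialDeriv i (fun x => a + b * f (c • x)) = fun x => b * c * partialDeriv i f (c • x) := by
  ext x
  have h1 : HasFDerivAt (fun x : EuclideanSpace ℝ (Fin n) => c • x)
      (c • ContinuousLinearMap.id ℝ (EuclideanSpace ℝ (Fin n))) x :=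
    (hasFDerivAt_id x).const_smul c
  have h2 := ((((hf.differentiable (by simp)).differentiableAt (x := c • x)).hasFDerivAt.comp x
    h1).const_mul b).const_add a
  unfold partialDeriv
  rw [show (fun x => a + b * f (c • x)) = fun x => a + b * (f ∘ fun x => c • x) x from rfl,
    h2.fderiv]
  simp
  ring

theorem lap_affine_comp_smul (hf : ContDiff ℝ ∞ f) (a b c : ℝ) (x : EuclideanSpace ℝ (Fin n)) :
    lap (fun x => a + b * f (c • x)) x = b * c ^ 2 * lap f (c • x) := by
  rw [lap_eq_sum, lap_eq_sum, Finset.mul_sum]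
  refine Finset.sum_congr rfl fun i _ => ?_
  have h := congrFun (partialDeriv_affine_comp_smul (hf.partialDeriv i) 0 (b * c) c i) x
  simp only [zero_add] at h
  rw [partialDeriv_affine_comp_smul hf, h]
  ring

theorem partialDeriv_exp (hf : ContDiff ℝ ∞ f) (i : Fin n) :
    partialDeriv i (fun x => Real.exp (f x)) = fun x => Real.exp (f x) * partialDeriv i f x := by
  ext x
  unfold partialDeriv
  rw [((hf.differentiable (by simp)).differentiableAt (x := x)).hasFDerivAt.exp.fderiv]
  simp

theorem sum_partialDeriv_exp_sq (hf : ContDiff ℝ ∞ f) (x : EuclideanSpace ℝ (Fin n)) :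
    ∑ i, partialDeriv i (fun x => Real.exp (f x)) x ^ 2 =
      (∑ i, partialDeriv i f x ^ 2) * Real.exp (f x) ^ 2 := by
  simp only [partialDeriv_exp hf, Finset.sum_mul]
  exact Finset.sum_congr rfl fun i _ => by ring

theorem lap_exp (hf : ContDiff ℝ ∞ f) (x : EuclideanSpace ℝ (Fin n)) :
    lap (fun x => Real.exp (f x)) x =
      (∑ i, partialDeriv i f x ^ 2 + lap f x) * Real.exp (f x) := by
  rw [lap_eq_sum, lap_eq_sum, ← Finset.sum_add_distrib, Finset.sum_mul]
  refine Finset.sum_congr rfl fun i _ => ?_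
  rw [partialDeriv_exp hf, partialDeriv_mul hf.exp (hf.partialDeriv i), partialDeriv_exp hf]
  ring

theorem exists_bound_partialDeriv_lap (hf : ContDiff ℝ ∞ f) (hc : HasCompactSupport f) :
    ∃ c : ℝ, 1 ≤ c ∧ ∀ x, ∑ i, partialDeriv i f x ^ 2 ≤ c ∧ |lap f x| ≤ c := by
  obtain ⟨a, ha⟩ := hc.lap.exists_bound_of_continuous hf.lap.continuous
  choose b hb using fun i =>
    (hc.partialDeriv i).exists_bound_of_continuous (hf.partialDeriv i).continuous
  have h0 : 0 ≤ ∑ i, b i ^ 2 := Finset.sum_nonneg fun i _ => sq_nonneg _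
  have ha0 : 0 ≤ a := (norm_nonneg _).trans (ha 0)
  refine ⟨1 + a + ∑ i, b i ^ 2, by linarith, fun x => ⟨?_, ?_⟩⟩
  · have : ∑ i, partialDeriv i f x ^ 2 ≤ ∑ i, b i ^ 2 := by
      refine Finset.sum_le_sum fun i _ => ?_
      rw [← sq_abs]
      gcongr
      exact hb i x
    linarith
  · have := ha x
    rw [Real.norm_eq_abs] at this
    linarith

/-- Multiplying a weight by a cutoff function keeps the bounds on its derivatives. -/
theorem partialDeriv_lap_mul_cutoff_le (hf : ContDiff ℝ ∞ f) (hg : ContDiff ℝ ∞ g) {m : ℝ}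
    {x : EuclideanSpace ℝ (Fin n)} (hf0 : 0 ≤ f x) (hf1 : f x ≤ 1) (hg0 : 0 ≤ g x)
    (hdf : ∑ i, partialDeriv i f x ^ 2 ≤ m ^ 2) (hlf : |lap f x| ≤ m ^ 2)
    (hdg : ∑ i, partialDeriv i g x ^ 2 ≤ m ^ 2 * g x ^ 2) (hlg : |lap g x| ≤ m ^ 2 * g x) :
    ∑ i, partialDeriv i (fun x => f x * g x) x ^ 2 ≤ (2 * m) ^ 2 * g x ^ 2 ∧
      |lap (fun x => f x * g x) x| ≤ (2 * m) ^ 2 * g x := by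
  constructor
  · have h : ∑ i, partialDeriv i (fun x => f x * g x) x ^ 2 ≤
        ∑ i, (2 * g x ^ 2 * partialDeriv i f x ^ 2 + 2 * partialDeriv i g x ^ 2) := by
      refine Finset.sum_le_sum fun i _ => ?_
      rw [partialDeriv_mul hf hg]
      have h1 : f x ^ 2 * partialDeriv i g x ^ 2 ≤ 1 ^ 2 * partialDeriv i g x ^ 2 := by gcongr
      nlinarith [sq_nonneg (partialDeriv i f x * g x - f x * partialDeriv i g x)]
    rw [Finset.sum_add_distrib, ← Finset.mul_sum, ← Finset.mul_sum] at h
    have : 2 * g x ^ 2 * ∑ i, partialDeriv i f x ^ 2 ≤ 2 * g x ^ 2 * m ^ 2 := by gcongr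
    linarith
  · have hc := Finset.sum_mul_sq_le_sq_mul_sq Finset.univ (fun i => partialDeriv i f x)
      (fun i => partialDeriv i g x)
    have h1 : |∑ i, partialDeriv i f x * partialDeriv i g x| ≤ m ^ 2 * g x := by
      refine abs_le_of_sq_le_sq (hc.trans ?_) (by positivity)
      calc _ ≤ m ^ 2 * (m ^ 2 * g x ^ 2) := by gcongr
        _ = _ := by ring
    rw [lap_mul hf hg]
    calc _ ≤ |lap f x * g x| + |2 * ∑ i, partialDeriv i f x * partialDeriv i g x|
          + |f x * lap g x| := abs_add_three _ _ _
      _ = |lap f x| * g x + 2 * |∑ i, partialDeriv i f x * partialDeriv i g x|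
          + f x * |lap g x| := by
        rw [abs_mul, abs_mul, abs_mul, abs_of_nonneg hg0, abs_of_nonneg hf0, abs_two]
      _ ≤ m ^ 2 * g x + 2 * (m ^ 2 * g x) + 1 * (m ^ 2 * g x) := by gcongr
      _ = _ := by ring

/-- The exponential weight `exp (k (1 - f (x / R)))` built from a cutoff function `f`. -/
theorem partialDeriv_lap_exp_cutoff_le (hf : ContDiff ℝ ∞ f) {c k R m : ℝ} (hc : 0 ≤ c)
    (hk : 0 ≤ k) (hm : c * (k ^ 2 + k) * R⁻¹ ^ 2 ≤ m ^ 2)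
    (hdf : ∀ x, ∑ i, partialDeriv i f x ^ 2 ≤ c) (hlf : ∀ x, |lap f x| ≤ c)
    (x : EuclideanSpace ℝ (Fin n)) :
    ∑ i, partialDeriv i (fun x => Real.exp (k + -k * f (R⁻¹ • x))) x ^ 2 ≤
        m ^ 2 * Real.exp (k + -k * f (R⁻¹ • x)) ^ 2 ∧
      |lap (fun x => Real.exp (k + -k * f (R⁻¹ • x))) x| ≤
        m ^ 2 * Real.exp (k + -k * f (R⁻¹ • x)) := by
  have hs : ContDiff ℝ ∞ fun x => k + -k * f (R⁻¹ • x) :=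
    contDiff_const.add (contDiff_const.mul (hf.comp (contDiff_id.const_smul _)))
  have h1 : ∑ i, partialDeriv i (fun x => k + -k * f (R⁻¹ • x)) x ^ 2 ≤ k ^ 2 * R⁻¹ ^ 2 * c := by
    calc _ = k ^ 2 * R⁻¹ ^ 2 * ∑ i, partialDeriv i f (R⁻¹ • x) ^ 2 := by
          rw [Finset.mul_sum]
          refine Finset.sum_congr rfl fun i _ => ?_
          rw [partialDeriv_affine_comp_smul hf]
          ring
      _ ≤ _ := by gcongr; exact hdf _
  have h2 : |lap (fun x => k + -k * f (R⁻¹ • x)) x| ≤ k * R⁻¹ ^ 2 * c := by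
    rw [lap_affine_comp_smul hf, abs_mul, abs_mul, abs_neg, abs_of_nonneg hk,
      abs_of_nonneg (sq_nonneg _)]
    gcongr
    exact hlf _
  have h0 : 0 ≤ ∑ i, partialDeriv i (fun x => k + -k * f (R⁻¹ • x)) x ^ 2 :=
    Finset.sum_nonneg fun i _ => sq_nonneg _
  have h3 : 0 ≤ k * R⁻¹ ^ 2 * c := by positivity
  constructor
  · rw [sum_partialDeriv_exp_sq hs]
    gcongr
    linarith
  · rw [lap_exp hs, abs_mul, abs_of_pos (Real.exp_pos _)]
    gcongr
    refine (abs_add_le _ _).trans ?_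
    rw [abs_of_nonneg h0]
    linarith

end Weights

section Solutions

variable {n : ℕ} {u : EuclideanSpace ℝ (Fin n) → ℝ → ℝ} {T : ℝ}

namespace IsBiharmonicHeatSol

theorem contDiff (hu : IsBiharmonicHeatSol u (univ ×ˢ Icc 0 T)) {t : ℝ} (ht : t ∈ Icc 0 T) :
    ContDiff ℝ ∞ fun x => u x t := by
  rw [← contDiffOn_univ]
  exact hu.1.comp (f := fun x => (x, t)) (contDiff_id.prodMk contDiff_const).contDiffOn
    fun x _ => ⟨mem_univ _, ht⟩

theorem hasDerivWithinAt (hu : IsBiharmonicHeatSol u (univ ×ˢ Icc 0 T)) {t : ℝ}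
    (ht : t ∈ Icc 0 T) (x : EuclideanSpace ℝ (Fin n)) :
    HasDerivWithinAt (u x) (-(lap (lap fun y => u y t) x)) (Icc 0 T) t := by
  have h := hu.2 (x, t) ⟨mem_univ _, ht⟩
  rwa [show {s | ((x, t).1, s) ∈ (univ : Set (EuclideanSpace ℝ (Fin n))) ×ˢ Icc 0 T} = Icc 0 T by
    ext; simp] at h

theorem continuousOn_lap_lap (hu : IsBiharmonicHeatSol u (univ ×ˢ Icc 0 T)) (hT : 0 < T) :
    ContinuousOn (fun q : EuclideanSpace ℝ (Fin n) × ℝ => lap (lap fun y => u y q.2) q.1)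
      (univ ×ˢ Icc 0 T) := by
  have hU : UniqueDiffOn ℝ ((univ : Set (EuclideanSpace ℝ (Fin n))) ×ˢ Icc 0 T) :=
    uniqueDiffOn_univ.prod (uniqueDiffOn_Icc hT)
  have h := ((hu.1.continuousOn_fderivWithin hU (by simp)).clm_apply
    (continuousOn_const (c := ((0 : EuclideanSpace ℝ (Fin n)), (1 : ℝ))))).neg
  refine h.congr ?_
  rintro ⟨x, t⟩ ⟨-, ht⟩
  have h1 := ((hu.1.differentiableOn (by simp)) (x, t) ⟨mem_univ _, ht⟩).hasFDerivWithinAt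
  have h2 : HasDerivWithinAt (fun s : ℝ => (x, s)) ((0 : EuclideanSpace ℝ (Fin n)), (1 : ℝ))
      (Icc 0 T) t := (hasDerivWithinAt_const t _ x).prodMk (hasDerivWithinAt_id t _)
  have h3 := h1.comp_hasDerivWithinAt t h2 fun s hs => ⟨mem_univ _, hs⟩
  have h4 := (uniqueDiffOn_Icc hT t ht).eq_deriv _ h3 (hu.hasDerivWithinAt ht x)
  simp only [Pi.neg_apply]
  rw [h4, neg_neg]

theorem continuousOn_integral_sq (hu : IsBiharmonicHeatSol u (univ ×ˢ Icc 0 T))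
    {p : EuclideanSpace ℝ (Fin n) → ℝ} (hp : Continuous p) (hpc : HasCompactSupport p) :
    ContinuousOn (fun t => ∫ x, p x ^ 4 * u x t ^ 2) (Icc 0 T) := by
  refine continuousOn_integral_of_compact_support hpc.isCompact ?_ fun t x _ hx => ?_
  · have h : ContinuousOn (fun q : ℝ × EuclideanSpace ℝ (Fin n) => u q.2 q.1)
        (Icc 0 T ×ˢ univ) :=
      hu.1.continuousOn.comp continuous_swap.continuousOn fun q hq => ⟨hq.2, hq.1⟩
    exact ((hp.comp continuous_snd).pow 4).continuousOn.mul (h.pow 2)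
  · simp [image_eq_zero_of_notMem_tsupport hx]

theorem hasDerivAt_integral_sq (hu : IsBiharmonicHeatSol u (univ ×ˢ Icc 0 T))
    {p : EuclideanSpace ℝ (Fin n) → ℝ} (hp : Continuous p) (hpc : HasCompactSupport p)
    {t : ℝ} (ht : t ∈ Ioo 0 T) :
    HasDerivAt (fun t => ∫ x, p x ^ 4 * u x t ^ 2)
      (∫ x, p x ^ 4 * (2 * u x t * -(lap (lap fun y => u y t) x))) t := by
  have hT : 0 < T := ht.1.trans ht.2
  have hF : ContinuousOn (fun q : EuclideanSpace ℝ (Fin n) × ℝ =>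
      p q.1 ^ 4 * (2 * u q.1 q.2 * -(lap (lap fun y => u y q.2) q.1)))
      (univ ×ˢ Icc 0 T) :=
    ((hp.comp continuous_fst).pow 4).continuousOn.mul
      ((continuousOn_const.mul hu.1.continuousOn).mul (hu.continuousOn_lap_lap hT).neg)
  obtain ⟨C, hC⟩ := (hpc.isCompact.prod
    (isCompact_Icc (a := 0) (b := T))).exists_bound_of_continuousOn
      (hF.mono (prod_mono (subset_univ _) subset_rfl))
  have hcu : ∀ s ∈ Icc 0 T, Continuous fun x => u x s := fun s hs => (hu.contDiff hs).continuous
  refine (hasDerivAt_integral_of_dominated_loc_of_deriv_le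
    (F := fun t x => p x ^ 4 * u x t ^ 2)
    (F' := fun t x => p x ^ 4 * (2 * u x t * -(lap (lap fun y => u y t) x)))
    (bound := (tsupport p).indicator fun _ => C) (Ioo_mem_nhds ht.1 ht.2) ?_ ?_ ?_ ?_ ?_ ?_).2
  · filter_upwards [Ioo_mem_nhds ht.1 ht.2] with s hs
    exact ((hp.pow 4).mul ((hcu s (Ioo_subset_Icc_self hs)).pow 2)).aestronglyMeasurable
  · refine ((hp.pow 4).mul
      ((hcu t (Ioo_subset_Icc_self ht)).pow 2)).integrable_of_hasCompactSupport ?_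
    exact HasCompactSupport.intro hpc.isCompact fun x hx => by
      simp [image_eq_zero_of_notMem_tsupport hx]
  · have h2 := (hu.contDiff (Ioo_subset_Icc_self ht)).lap.lap.continuous
    exact ((hp.pow 4).mul ((continuous_const.mul
      (hcu t (Ioo_subset_Icc_self ht))).mul h2.neg)).aestronglyMeasurable
  · refine .of_forall fun x s hs => ?_
    by_cases hx : x ∈ tsupport p
    · rw [indicator_of_mem hx]
      exact hC (x, s) ⟨hx, Ioo_subset_Icc_self hs⟩
    · simp [hx, image_eq_zero_of_notMem_tsupport hx]
  · exact (integrable_indicator_iff hpc.isCompact.measurableSet).2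
      (integrableOn_const hpc.isCompact.measure_lt_top.ne)
  · refine .of_forall fun x s hs => ?_
    have h := (hu.hasDerivWithinAt (Ioo_subset_Icc_self hs) x).hasDerivAt (Icc_mem_nhds hs.1 hs.2)
    simpa using (h.pow 2).const_mul (p x ^ 4)

/-- Comparison principle for the localized weighted `L²` norm of a solution. -/
theorem integral_sq_le (hu : IsBiharmonicHeatSol u (univ ×ˢ Icc 0 T))
    {p g : EuclideanSpace ℝ (Fin n) → ℝ} {m : ℝ} (hp : ContDiff ℝ ∞ p)
    (hg : ContDiff ℝ ∞ g) (hpc : HasCompactSupport p) (hp0 : ∀ x, 0 ≤ p x)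
    (hpg : ∀ x, p x ≤ g x)
    (hdp : ∀ x, ∑ i, partialDeriv i p x ^ 2 ≤ m ^ 2 * g x ^ 2)
    (hdg : ∀ x, ∑ i, partialDeriv i g x ^ 2 ≤ m ^ 2 * g x ^ 2)
    (hlp : ∀ x, |lap p x| ≤ m ^ 2 * g x) (hlg : ∀ x, |lap g x| ≤ m ^ 2 * g x)
    (hint : ∀ t ∈ Icc 0 T, Integrable fun x => g x ^ 4 * u x t ^ 2)
    {B B' : ℝ → ℝ} (hB : ∀ t, HasDerivAt B (B' t) t) (hB0 : ∫ x, p x ^ 4 * u x 0 ^ 2 ≤ B 0)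
    (hB' : ∀ t ∈ Icc 0 T, 9728 * m ^ 4 * ∫ x, g x ^ 4 * u x t ^ 2 ≤ B' t)
    {t : ℝ} (ht : t ∈ Icc 0 T) : ∫ x, p x ^ 4 * u x t ^ 2 ≤ B t := by
  have hd : ∀ s ∈ Ioo 0 T, HasDerivAt (fun t => (∫ x, p x ^ 4 * u x t ^ 2) - B t)
      ((∫ x, p x ^ 4 * (2 * u x s * -(lap (lap fun y => u y s) x))) - B' s) s := fun s hs =>
    (hu.hasDerivAt_integral_sq hp.continuous hpc hs).sub (hB s)
  have hanti : AntitoneOn (fun t => (∫ x, p x ^ 4 * u x t ^ 2) - B t) (Icc 0 T) := by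
    refine antitoneOn_of_deriv_nonpos (convex_Icc 0 T)
      ((hu.continuousOn_integral_sq hp.continuous hpc).sub
        (continuous_iff_continuousAt.2 fun s => (hB s).continuousAt).continuousOn) ?_ ?_
    · rw [interior_Icc]
      exact fun s hs => (hd s hs).differentiableAt.differentiableWithinAt
    · rw [interior_Icc]
      intro s hs
      have hs' := Ioo_subset_Icc_self hs
      have h1 := integral_mul_lap_lap_ge (hu.contDiff hs') hp hg hpc hp0 hpg hdp hdg hlp hlg
        (hint s hs')
      have h2 : ∫ x, p x ^ 4 * (2 * u x s * -(lap (lap fun y => u y s) x)) =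
          -2 * ∫ x, u x s * lap (lap fun y => u y s) x * p x ^ 4 := by
        rw [← integral_const_mul]
        exact integral_congr_ae (.of_forall fun x => by simp only; ring)
      rw [(hd s hs).deriv, h2]
      have h3 := hB' s hs'
      linarith
  have h := hanti (left_mem_Icc.2 (ht.1.trans ht.2)) ht ht.1
  simp only at h
  linarith

end IsBiharmonicHeatSol

end Solutions
section Decay

variable {n : ℕ}

/-- If a nonnegative weight has slowly varying derivatives, its products with cutoff functions at
large scales satisfy the same type of bounds. -/
theorem exists_cutoff_sequence {g : EuclideanSpace ℝ (Fin n) → ℝ} {m : ℝ}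
    (hg : ContDiff ℝ ∞ g) (hg0 : ∀ x, 0 ≤ g x) (hm : 0 < m)
    (hdg : ∀ x, ∑ i, partialDeriv i g x ^ 2 ≤ m ^ 2 * g x ^ 2)
    (hlg : ∀ x, |lap g x| ≤ m ^ 2 * g x) :
    ∃ p : ℕ → EuclideanSpace ℝ (Fin n) → ℝ,
      (∀ k, ContDiff ℝ ∞ (p k) ∧ HasCompactSupport (p k)) ∧
      (∀ k x, 0 ≤ p k x ∧ p k x ≤ g x) ∧
      (∀ x, ∀ᶠ k in atTop, p k x = g x) ∧
      ∀ᶠ k in atTop, ∀ x, ∑ i, partialDeriv i (p k) x ^ 2 ≤ (2 * m) ^ 2 * g x ^ 2 ∧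
        |lap (p k) x| ≤ (2 * m) ^ 2 * g x := by
  let χ : ContDiffBump (0 : EuclideanSpace ℝ (Fin n)) := ⟨1, 2, one_pos, one_lt_two⟩
  have hχ : ContDiff ℝ ∞ χ := χ.contDiff
  obtain ⟨c, hc1, hc⟩ := exists_bound_partialDeriv_lap hχ χ.hasCompactSupport
  have hη : ∀ k : ℕ, ContDiff ℝ ∞ fun x => χ (((k : ℝ) + 1)⁻¹ • x) := fun k =>
    hχ.comp (contDiff_id.const_smul _)
  refine ⟨fun k x => χ (((k : ℝ) + 1)⁻¹ • x) * g x, fun k => ⟨(hη k).mul hg, ?_⟩,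
    fun k x => ⟨mul_nonneg χ.nonneg (hg0 x), mul_le_of_le_one_left (hg0 x) χ.le_one⟩,
    fun x => ?_, ?_⟩
  · exact (χ.hasCompactSupport.comp_smul (by positivity : ((k : ℝ) + 1)⁻¹ ≠ 0)).mul_right
  · filter_upwards [tendsto_natCast_atTop_atTop.eventually_ge_atTop ‖x‖] with k hk
    rw [χ.one_of_mem_closedBall, one_mul]
    rw [mem_closedBall_zero_iff, norm_smul, norm_inv, Real.norm_of_nonneg (by positivity),
      inv_mul_le_iff₀ (by positivity)]
    change ‖x‖ ≤ ((k : ℝ) + 1) * 1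
    linarith
  · have hlim : Tendsto (fun k : ℕ => c * ((k : ℝ) + 1)⁻¹ ^ 2) atTop (𝓝 0) := by
      have h := ((tendsto_one_div_add_atTop_nhds_zero_nat (𝕜 := ℝ)).pow 2).const_mul c
      simpa using h
    filter_upwards [hlim.eventually_le_const (by positivity : 0 < m ^ 2)] with k hk x
    have h1 := fun i => partialDeriv_affine_comp_smul hχ 0 1 ((k : ℝ) + 1)⁻¹ i
    have h2 := lap_affine_comp_smul hχ 0 1 ((k : ℝ) + 1)⁻¹ x
    simp only [zero_add, one_mul] at h1 h2
    refine partialDeriv_lap_mul_cutoff_le (hη k) hg χ.nonneg χ.le_one (hg0 x) ?_ ?_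
      (hdg x) (hlg x)
    · simp only [h1, mul_pow, ← Finset.mul_sum]
      refine le_trans ?_ hk
      rw [mul_comm]
      gcongr
      exact (hc _).1
    · rw [h2, abs_mul, abs_of_nonneg (sq_nonneg _)]
      refine le_trans ?_ hk
      rw [mul_comm]
      gcongr
      exact (hc _).2

/-- Growth of the weighted `L²` norm of a solution, for a bounded weight with slowly varying
derivatives. -/
theorem IsBiharmonicHeatSol.integral_weight_mul_sq_le
    {u : EuclideanSpace ℝ (Fin n) → ℝ → ℝ} {T : ℝ}
    (hu : IsBiharmonicHeatSol u (univ ×ˢ Icc 0 T))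
    (hint : ∀ t ∈ Icc 0 T, Integrable fun x => u x t ^ 2)
    {M : ℝ} (hM : ∀ t ∈ Icc 0 T, ∫ x, u x t ^ 2 ≤ M)
    {g : EuclideanSpace ℝ (Fin n) → ℝ} {m G : ℝ} (hg : ContDiff ℝ ∞ g) (hg0 : ∀ x, 0 ≤ g x)
    (hgG : ∀ x, g x ≤ G) (hm : 0 < m)
    (hdg : ∀ x, ∑ i, partialDeriv i g x ^ 2 ≤ m ^ 2 * g x ^ 2)
    (hlg : ∀ x, |lap g x| ≤ m ^ 2 * g x) {t : ℝ} (ht : t ∈ Icc 0 T) :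
    Integrable (fun x => g x ^ 4 * u x t ^ 2) ∧
      ∫ x, g x ^ 4 * u x t ^ 2 ≤
        Real.exp (9728 * (2 * m) ^ 4 * t) * ∫ x, g x ^ 4 * u x 0 ^ 2 := by
  have hT : 0 ≤ T := ht.1.trans ht.2
  have hpow : ∀ x, g x ^ 4 ≤ G ^ 4 := fun x => pow_le_pow_left₀ (hg0 x) (hgG x) 4
  have hi : ∀ t ∈ Icc 0 T, Integrable fun x => g x ^ 4 * u x t ^ 2 := fun t ht => by
    refine (hint t ht).bdd_mul (c := G ^ 4) (hg.continuous.pow 4).aestronglyMeasurable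
      (.of_forall fun x => ?_)
    rw [Real.norm_of_nonneg (by have := hg0 x; positivity)]
    exact hpow x
  refine ⟨hi t ht, ?_⟩
  set J : ℝ → ℝ := fun t => ∫ x, g x ^ 4 * u x t ^ 2
  have hJM : ∀ t ∈ Icc 0 T, J t ≤ G ^ 4 * M := fun t ht => by
    have hG : 0 ≤ G ^ 4 := by positivity
    calc J t ≤ ∫ x, G ^ 4 * u x t ^ 2 := by
          refine integral_mono (hi t ht) ((hint t ht).const_mul _) fun x => ?_
          exact mul_le_mul_of_nonneg_right (hpow x) (sq_nonneg _)
      _ = G ^ 4 * ∫ x, u x t ^ 2 := integral_const_mul _ _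
      _ ≤ G ^ 4 * M := by gcongr; exact hM t ht
  have hJ0 : 0 ≤ J 0 := integral_nonneg fun x => by have := hg0 x; positivity
  obtain ⟨p, hp, hpg, hplim, hpd⟩ := exists_cutoff_sequence hg hg0 hm hdg hlg
  have hple : ∀ k x t, p k x ^ 4 * u x t ^ 2 ≤ g x ^ 4 * u x t ^ 2 := fun k x t =>
    mul_le_mul_of_nonneg_right (pow_le_pow_left₀ (hpg k x).1 (hpg k x).2 4) (sq_nonneg _)
  have hJlim : ∀ t ∈ Icc 0 T,
      Tendsto (fun k => ∫ x, p k x ^ 4 * u x t ^ 2) atTop (𝓝 (J t)) := fun t ht => by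
    refine tendsto_integral_of_dominated_convergence _ (fun k => ?_) (hi t ht)
      (fun k => .of_forall fun x => ?_) (.of_forall fun x => ?_)
    · exact (((hp k).1.continuous.pow 4).mul
        ((hu.contDiff ht).continuous.pow 2)).aestronglyMeasurable
    · rw [Real.norm_of_nonneg (by have := (hpg k x).1; positivity)]
      exact hple k x t
    · refine tendsto_const_nhds.congr' ?_
      filter_upwards [hplim x] with k hk
      rw [hk]
  set K := 9728 * (2 * m) ^ 4
  have hK0 : 0 ≤ K := by positivity
  have hm4 : m ^ 2 ≤ (2 * m) ^ 2 := by nlinarith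
  have iter : ∀ k : ℕ, ∀ t ∈ Icc 0 T,
      J t ≤ Real.exp (K * t) * J 0 + G ^ 4 * M * ((K * t) ^ k / k.factorial) := by
    intro k
    induction k with
    | zero =>
      intro t ht
      have := mul_nonneg (Real.exp_pos (K * t)).le hJ0
      have := hJM t ht
      simp only [pow_zero, Nat.factorial_zero, Nat.cast_one, div_one, mul_one]
      linarith
    | succ k ih =>
      intro t ht
      refine le_of_tendsto (hJlim t ht) ?_
      filter_upwards [hpd] with j hj
      have hB : ∀ s : ℝ, HasDerivAt
          (fun s => Real.exp (K * s) * J 0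
            + G ^ 4 * M * ((K * s) ^ (k + 1) / (k + 1).factorial))
          (K * (Real.exp (K * s) * J 0 + G ^ 4 * M * ((K * s) ^ k / k.factorial))) s := by
        intro s
        have h1 : HasDerivAt (fun s => K * s) K s := by
          simpa using (hasDerivAt_id s).const_mul K
        refine ((h1.exp.mul_const (J 0)).add (((h1.pow (k + 1)).div_const
          ((k + 1).factorial : ℝ)).const_mul (G ^ 4 * M))).congr_deriv ?_
        rw [Nat.factorial_succ]
        have : (k.factorial : ℝ) ≠ 0 := by positivity
        have : ((k : ℝ) + 1) ≠ 0 := by positivity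
        push_cast
        field_simp
      refine hu.integral_sq_le (m := 2 * m) (hp j).1 hg (hp j).2 (fun x => (hpg j x).1)
        (fun x => (hpg j x).2) (fun x => (hj x).1)
        (fun x => (hdg x).trans (by gcongr)) (fun x => (hj x).2)
        (fun x => (hlg x).trans (mul_le_mul_of_nonneg_right hm4 (hg0 x))) hi hB ?_
        (fun s hs => mul_le_mul_of_nonneg_left (ih s hs) hK0) ht
      have h0 : ∫ x, p j x ^ 4 * u x 0 ^ 2 ≤ J 0 := by
        have h0T : (0 : ℝ) ∈ Icc 0 T := left_mem_Icc.2 hT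
        refine integral_mono_of_nonneg (.of_forall fun x => ?_) (hi 0 h0T)
          (.of_forall fun x => hple j x 0)
        have := (hpg j x).1
        positivity
      simpa using h0
  have hlim := ((FloorSemiring.tendsto_pow_div_factorial_atTop (K * t)).const_mul
    (G ^ 4 * M)).const_add (Real.exp (K * t) * J 0)
  rw [mul_zero, add_zero] at hlim
  exact ge_of_tendsto' hlim fun k => iter k t ht

/-- The weighted estimate with an exponential weight that equals `1` on `B(0,R)` and `exp k`
outside `B(0,2R)`. -/
theorem exists_integral_compl_ball_le (n : ℕ) :
    ∃ c : ℝ, 1 ≤ c ∧ ∀ (R T k m : ℝ) (u : EuclideanSpace ℝ (Fin n) → ℝ → ℝ), 0 < R → 0 ≤ k →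
      0 < m → c * (k ^ 2 + k) * R⁻¹ ^ 2 ≤ m ^ 2 →
      IsBiharmonicHeatSol u (univ ×ˢ Icc 0 T) →
      (∀ t ∈ Icc (0 : ℝ) T, Integrable fun x => u x t ^ 2) →
      (∃ M : ℝ, ∀ t ∈ Icc (0 : ℝ) T, ∫ x, u x t ^ 2 ≤ M) →
      (Function.support (fun x => u x 0) ⊆ ball 0 R) →
      ∀ t ∈ Icc (0 : ℝ) T,
        Real.exp (4 * k) * ∫ x in (ball (0 : EuclideanSpace ℝ (Fin n)) (2 * R))ᶜ, u x t ^ 2 ≤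
          Real.exp (9728 * (2 * m) ^ 4 * t) *
            ∫ x in ball (0 : EuclideanSpace ℝ (Fin n)) R, u x 0 ^ 2 := by
  let χ : ContDiffBump (0 : EuclideanSpace ℝ (Fin n)) := ⟨1, 2, one_pos, one_lt_two⟩
  have hχ : ContDiff ℝ ∞ χ := χ.contDiff
  obtain ⟨c, hc1, hc⟩ := exists_bound_partialDeriv_lap hχ χ.hasCompactSupport
  refine ⟨c, hc1, fun R T k m u hR hk hm hkm hu hint ⟨M, hM⟩ hsupp t ht => ?_⟩
  have hbd := partialDeriv_lap_exp_cutoff_le hχ (by linarith) hk hkm (fun x => (hc x).1)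
    (fun x => (hc x).2)
  set g : EuclideanSpace ℝ (Fin n) → ℝ := fun x => Real.exp (k + -k * χ (R⁻¹ • x)) with hg_def
  have hg : ContDiff ℝ ∞ g :=
    (contDiff_const.add (contDiff_const.mul (hχ.comp (contDiff_id.const_smul _)))).exp
  have hg0 : ∀ x, 0 ≤ g x := fun x => (Real.exp_pos _).le
  have hgG : ∀ x, g x ≤ Real.exp k := fun x => by
    refine Real.exp_le_exp.2 ?_
    have := mul_nonneg hk (χ.nonneg (x := R⁻¹ • x))
    linarith
  have hin : ∀ x ∈ ball (0 : EuclideanSpace ℝ (Fin n)) R, g x = 1 := fun x hx => by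
    have h1 : χ (R⁻¹ • x) = 1 := by
      refine χ.one_of_mem_closedBall ?_
      rw [mem_closedBall_zero_iff, norm_smul, norm_inv, Real.norm_of_nonneg hR.le,
        inv_mul_le_iff₀ hR]
      change ‖x‖ ≤ R * 1
      rw [mem_ball_zero_iff] at hx
      linarith
    simp [hg_def, h1]
  have hout : ∀ x ∈ (ball (0 : EuclideanSpace ℝ (Fin n)) (2 * R))ᶜ, g x = Real.exp k :=
    fun x hx => by
      have h1 : χ (R⁻¹ • x) = 0 := by
        refine χ.zero_of_le_dist ?_
        rw [dist_zero_right, norm_smul, norm_inv, Real.norm_of_nonneg hR.le,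
          le_inv_mul_iff₀ hR]
        change R * 2 ≤ ‖x‖
        rw [mem_compl_iff, mem_ball_zero_iff] at hx
        linarith
      simp [hg_def, h1]
  obtain ⟨hgi, hle⟩ := hu.integral_weight_mul_sq_le hint hM hg hg0 hgG hm (fun x => (hbd x).1)
    (fun x => (hbd x).2) ht
  have h1 : Real.exp (4 * k) * ∫ x in (ball (0 : EuclideanSpace ℝ (Fin n)) (2 * R))ᶜ, u x t ^ 2 ≤
      ∫ x, g x ^ 4 * u x t ^ 2 := by
    rw [← integral_const_mul]
    calc _ = ∫ x in (ball (0 : EuclideanSpace ℝ (Fin n)) (2 * R))ᶜ, g x ^ 4 * u x t ^ 2 := by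
          refine setIntegral_congr_fun measurableSet_ball.compl fun x hx => ?_
          simp only [hout x hx, ← Real.exp_nat_mul]
          norm_num
      _ ≤ _ := setIntegral_le_integral hgi (.of_forall fun x => by have := hg0 x; positivity)
  have h2 : ∫ x, g x ^ 4 * u x 0 ^ 2 =
      ∫ x in ball (0 : EuclideanSpace ℝ (Fin n)) R, u x 0 ^ 2 := by
    rw [← integral_indicator measurableSet_ball]
    refine integral_congr_ae (.of_forall fun x => ?_)
    by_cases hx : x ∈ ball (0 : EuclideanSpace ℝ (Fin n)) R
    · simp [indicator_of_mem hx, hin x hx]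
    · have : u x 0 = 0 := by
        by_contra h
        exact hx (hsupp h)
      simp [indicator_of_notMem hx, this]
  rw [h2] at hle
  exact h1.trans hle

end Decay

/-- `L²` exponential decay estimate (Section 4.2 of the paper, Euclidean case):
for an `L²` solution of the biharmonic heat equation whose initial data is
supported in `B(0,R)`, the `L²` mass outside `B(0,2R)` at time `T/2` decays like
`exp(-R^{4/3}/(2AT^{1/3}))`, for a constant `A = A(n)`. -/
theorem biharmonic_heat_L2_exponential_decay (n : ℕ) :
    ∃ A : ℝ, 0 < A ∧
      ∀ R T : ℝ, 1 < R → 0 < T → T ≤ R →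
        ∀ u : EuclideanSpace ℝ (Fin n) → ℝ → ℝ,
          IsBiharmonicHeatSol u (Set.univ ×ˢ Set.Icc 0 T) →
          (∀ t ∈ Set.Icc (0:ℝ) T, Integrable (fun x => (u x t) ^ 2)) →
          (∃ M : ℝ, ∀ t ∈ Set.Icc (0:ℝ) T, ∫ x, (u x t) ^ 2 ≤ M) →
          (Function.support (fun x => u x 0) ⊆ Metric.ball 0 R) →
          ∫ x in (Metric.ball (0 : EuclideanSpace ℝ (Fin n)) (2 * R))ᶜ, (u x (T / 2)) ^ 2
            ≤ Real.exp (-(R ^ ((4:ℝ)/3)) / (2 * A * T ^ ((1:ℝ)/3)))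
              * ∫ x in Metric.ball (0 : EuclideanSpace ℝ (Fin n)) R, (u x 0) ^ 2 := by
  obtain ⟨c, hc1, hc⟩ := exists_integral_compl_ball_le n
  have hc0 : 0 < c := by linarith
  set e : ℝ := (640000 * c ^ 2)⁻¹ with he
  have he0 : 0 < e := by positivity
  have he1 : e ≤ 1 := inv_le_one_of_one_le₀ (by nlinarith)
  refine ⟨e⁻¹, by positivity, fun R T hR hT hTR u hu hint hM hsupp => ?_⟩
  have hR0 : 0 < R := by linarith
  obtain ⟨r, hr1, hr3, hrX⟩ : ∃ r : ℝ, 1 ≤ r ∧ r ^ 3 * T = R ∧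
      R ^ ((4 : ℝ) / 3) = R * r * T ^ ((1 : ℝ) / 3) := by
    refine ⟨(R / T) ^ ((1 : ℝ) / 3), Real.one_le_rpow ((one_le_div hT).2 hTR) (by norm_num),
      ?_, ?_⟩
    · rw [← Real.rpow_natCast, ← Real.rpow_mul (by positivity)]
      norm_num
      field_simp
    · rw [mul_assoc, ← Real.mul_rpow (by positivity) hT.le, div_mul_cancel₀ _ hT.ne',
        show (4 : ℝ) / 3 = 1 + 1 / 3 by norm_num, Real.rpow_add hR0, Real.rpow_one]
  have hX : -(R ^ ((4 : ℝ) / 3)) / (2 * e⁻¹ * T ^ ((1 : ℝ) / 3)) = -(e * (R * r) / 2) := by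
    have : 0 < T ^ ((1 : ℝ) / 3) := by positivity
    rw [hrX]
    field_simp
  rw [hX]
  have hr0 : 0 < r := by linarith
  have hm2 : Real.sqrt (c * e) ^ 2 = c * e := Real.sq_sqrt (by positivity)
  have hkm : c * ((e * (R * r) / 4) ^ 2 + e * (R * r) / 4) * R⁻¹ ^ 2 ≤
      (Real.sqrt (c * e) * r) ^ 2 := by
    have h1 : c * ((e * (R * r) / 4) ^ 2 + e * (R * r) / 4) * R⁻¹ ^ 2 =
        c * e * (e * r ^ 2 / 16 + r / R / 4) := by
      field_simp
      ring
    have h2 : e * r ^ 2 ≤ 1 * r ^ 2 := by gcongr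
    have h3 : r / R ≤ r ^ 2 := (div_le_self hr0.le hR.le).trans (by nlinarith)
    rw [h1, mul_pow, hm2]
    gcongr
    nlinarith [sq_nonneg r]
  have hmain := hc R T (e * (R * r) / 4) (Real.sqrt (c * e) * r) u hR0 (by positivity)
    (by positivity) hkm hu hint hM hsupp (T / 2) ⟨by positivity, by linarith⟩
  set I := ∫ x in ball (0 : EuclideanSpace ℝ (Fin n)) R, u x 0 ^ 2
  have hI : 0 ≤ I := integral_nonneg fun x => sq_nonneg _
  have hexp : 9728 * (2 * (Real.sqrt (c * e) * r)) ^ 4 * (T / 2) ≤ e * (R * r) / 2 := by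
    have h1 : 9728 * (2 * (Real.sqrt (c * e) * r)) ^ 4 * (T / 2) =
        77824 * (c ^ 2 * e) * (e * (R * r)) := by
      rw [← hr3]
      calc _ = 77824 * (Real.sqrt (c * e) ^ 2) ^ 2 * r ^ 4 * T := by ring
        _ = _ := by rw [hm2]; ring
    have h2 : c ^ 2 * e = 640000⁻¹ := by
      rw [he]
      field_simp
    have h3 : 0 ≤ e * (R * r) := by positivity
    rw [h1, h2]
    linarith
  have h4 : 4 * (e * (R * r) / 4) = e * (R * r) := by ring
  rw [h4] at hmain
  have hsplit : Real.exp (e * (R * r) / 2) =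
      Real.exp (e * (R * r)) * Real.exp (-(e * (R * r) / 2)) := by
    rw [← Real.exp_add]
    ring_nf
  refine le_of_mul_le_mul_left (hmain.trans ?_) (Real.exp_pos (e * (R * r)))
  rw [← mul_assoc (Real.exp (e * (R * r))), ← hsplit]
  gcongr
end

section
/- Let n ≥ 3, let p > n/2, set q = p/(p−1) and k = n/((n−2)q) (so that k > 1), let 0 ≤ τ₀ < 1/2, and set α = (1+2τ₀) / ( 2(1+τ₀) + (k−1)^{−1} ), which lies in (0,1). Then there exist constants C > 0 and β > 0, depending only on n, p and τ₀, such that for every r > 0 and every smooth compactly supported function u : ℝⁿ → ℝ with support contained in B(0,r): ‖u‖_{L^∞} ≤ C · (ω_n rⁿ)^{−2β/n} · ‖u‖_{L^{(1+2τ₀)q}(B(0,r))}^{α} · ( r² ‖Δu‖_{L^{p}(B(0,r))} + ‖u‖_{L^{p}(B(0,r))} )^{1−α}, where ω_n is the Lebesgue volume of the unit ball in ℝⁿ. -/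
open MeasureTheory Metric Set Filter

lemma hasDerivAt_max_zero_sq (y : ℝ) :
    HasDerivAt (fun s : ℝ => (max 0 s) ^ 2) (2 * max 0 y) y := by
  rcases lt_trichotomy y 0 with hy | rfl | hy
  · have : (fun s : ℝ => (max 0 s) ^ 2) =ᶠ[nhds y] fun _ => 0 := by
      filter_upwards [Iio_mem_nhds hy] with s hs
      simp [max_eq_left (mem_Iio.1 hs).le]
    rw [max_eq_left hy.le, mul_zero]
    exact (hasDerivAt_const y (0 : ℝ)).congr_of_eventuallyEq this
  · rw [hasDerivAt_iff_isLittleO]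
    have h : (fun s : ℝ => s ^ 2) =o[nhds 0] fun s : ℝ => s := by
      simpa using Asymptotics.isLittleO_pow_pow (𝕜 := ℝ) (m := 1) (n := 2) (by norm_num)
    refine (Asymptotics.IsBigO.of_bound 1 ?_).trans_isLittleO (h.congr_right fun s => by simp)
    refine Eventually.of_forall fun s => ?_
    rcases le_total s 0 with hs | hs
    · simp [max_eq_left hs, sq_nonneg]
    · simp [max_eq_right hs]
  · have : (fun s : ℝ => (max 0 s) ^ 2) =ᶠ[nhds y] fun s => s ^ 2 := by
      filter_upwards [Ioi_mem_nhds hy] with s hs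
      simp [max_eq_right (mem_Ioi.1 hs).le]
    rw [max_eq_right hy.le]
    simpa using (hasDerivAt_pow 2 y).congr_of_eventuallyEq this

/-- A compactly supported radial kernel. -/
noncomputable def radialKernel {n : ℕ} (z : EuclideanSpace ℝ (Fin n)) : ℝ := max 0 (1 - ‖z‖ ^ 2)

/-- A compactly supported potential for the vector field `radialKernel z • z`. -/
noncomputable def radialPotential {n : ℕ} (z : EuclideanSpace ℝ (Fin n)) : ℝ :=
    -(1 / 4) * (max 0 (1 - ‖z‖ ^ 2)) ^ 2

lemma continuous_radialKernel {n : ℕ} : Continuous (radialKernel (n := n)) := by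
  unfold radialKernel; fun_prop

lemma continuous_radialPotential {n : ℕ} : Continuous (radialPotential (n := n)) := by
  unfold radialPotential; fun_prop

lemma radialKernel_nonneg {n : ℕ} (z : EuclideanSpace ℝ (Fin n)) : 0 ≤ radialKernel z :=
    le_max_left _ _

lemma max_one_sub_norm_sq_eq_zero {n : ℕ} {z : EuclideanSpace ℝ (Fin n)}
    (hz : z ∉ closedBall (0 : EuclideanSpace ℝ (Fin n)) 1) :
    max 0 (1 - ‖z‖ ^ 2) = 0 := by
  have : 1 < ‖z‖ := by simpa using hz
  exact max_eq_left (by nlinarith)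

lemma hasCompactSupport_radialKernel {n : ℕ} : HasCompactSupport (radialKernel (n := n)) :=
  HasCompactSupport.intro (isCompact_closedBall 0 1) fun _ hz => max_one_sub_norm_sq_eq_zero hz

lemma hasCompactSupport_radialPotential {n : ℕ} : HasCompactSupport (radialPotential (n := n)) :=
  HasCompactSupport.intro (isCompact_closedBall 0 1) fun z hz => by
    simp [radialPotential, max_one_sub_norm_sq_eq_zero hz]

lemma integral_radialKernel_pos {n : ℕ} : 0 < ∫ z : EuclideanSpace ℝ (Fin n), radialKernel z :=
  continuous_radialKernel.integral_pos_of_hasCompactSupport_nonneg_nonzero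
    hasCompactSupport_radialKernel radialKernel_nonneg (x := 0) (by simp [radialKernel])

lemma hasFDerivAt_radialPotential {n : ℕ} (z : EuclideanSpace ℝ (Fin n)) :
    HasFDerivAt radialPotential (radialKernel z • innerSL ℝ z) z := by
  have h1 : HasFDerivAt (fun z : EuclideanSpace ℝ (Fin n) => 1 - ‖z‖ ^ 2)
      (-(2 • innerSL ℝ z)) z := by
    simpa using ((hasFDerivAt_id z).norm_sq).const_sub 1
  have h2 := ((hasDerivAt_max_zero_sq (1 - ‖z‖ ^ 2)).const_mul (-(1 / 4) : ℝ)).comp_hasFDerivAt z h1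
  refine h2.congr_fderiv ?_
  ext v
  simp [radialKernel]
  ring

lemma fderiv_radialPotential_single {n : ℕ} (z : EuclideanSpace ℝ (Fin n)) (i : Fin n) :
    fderiv ℝ radialPotential z (EuclideanSpace.single i 1) = radialKernel z * z i := by
  simp [(hasFDerivAt_radialPotential z).fderiv, EuclideanSpace.inner_single_right]

lemma sum_apply_single {n : ℕ} (L : EuclideanSpace ℝ (Fin n) →L[ℝ] ℝ)
    (z : EuclideanSpace ℝ (Fin n)) :
    L z = ∑ i, z i * L (EuclideanSpace.single i 1) := by
  conv_lhs => rw [← (EuclideanSpace.basisFun (Fin n) ℝ).sum_repr z]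
  simp [map_sum]

lemma continuous_lap {n : ℕ} {u : EuclideanSpace ℝ (Fin n) → ℝ} (hu : ContDiff ℝ (⊤ : ℕ∞) u) :
    Continuous (lap u) := by
  unfold lap
  refine continuous_finsetSum _ fun i _ => ?_
  have h1 : ContDiff ℝ 1 fun y => fderiv ℝ u y (EuclideanSpace.single i 1) :=
    (hu.fderiv_right (m := 1) (by norm_cast)).clm_apply contDiff_const
  exact (h1.continuous_fderiv (by norm_num)).clm_apply continuous_const

lemma lap_eq_zero_of_notMem_tsupport {n : ℕ} {u : EuclideanSpace ℝ (Fin n) → ℝ}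
    {x : EuclideanSpace ℝ (Fin n)} (hx : x ∉ tsupport u) :
    lap u x = 0 := by
  refine Finset.sum_eq_zero fun i _ => ?_
  have h0 : (fun y => fderiv ℝ u y (EuclideanSpace.single i 1)) =ᶠ[nhds x] fun _ => 0 := by
    filter_upwards [(isClosed_tsupport u).isOpen_compl.mem_nhds hx] with y hy
    rw [fderiv_of_notMem_tsupport ℝ hy]; rfl
  rw [h0.fderiv_eq]
  simp

lemma hasCompactSupport_comp_sub_smul {n : ℕ} {w : EuclideanSpace ℝ (Fin n) → ℝ}
    (hw : HasCompactSupport w)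
    (x : EuclideanSpace ℝ (Fin n)) {t : ℝ} (ht : t ≠ 0) :
        HasCompactSupport fun z => w (x - t • z) :=
  hw.comp_homeomorph ((Homeomorph.smulOfNeZero t ht).trans (Homeomorph.subLeft x))

lemma integral_comp_sub_smul {n : ℕ} (w : EuclideanSpace ℝ (Fin n) → ℝ)
    (x : EuclideanSpace ℝ (Fin n)) {t : ℝ} (ht : 0 < t) :
    ∫ z, w (x - t • z) = (t ^ n)⁻¹ * ∫ z, w z := by
  rw [Measure.integral_comp_smul volume (fun z => w (x - z)) t, integral_sub_left_eq_self,
    finrank_euclideanSpace_fin, abs_of_pos (by positivity), smul_eq_mul]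

/-- Hölder's inequality for the convolution with a rescaled kernel. -/
lemma abs_integral_mul_comp_sub_smul_le {n : ℕ} {η w : EuclideanSpace ℝ (Fin n) → ℝ}
    (hη : Continuous η)
    (hη' : HasCompactSupport η) (hw : Continuous w) (hw' : HasCompactSupport w)
        (x : EuclideanSpace ℝ (Fin n))
    {t s : ℝ} (ht : 0 < t) (hs : 1 < s) :
    |∫ z, η z * w (x - t • z)| ≤
      (∫ z, |η z| ^ s.conjExponent) ^ (1 / s.conjExponent) * t ^ (-(n / s)) *
        (∫ z, |w z| ^ s) ^ (1 / s) := by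
  have hconj := (Real.HolderConjugate.conjExponent hs).symm
  have hw1 : Continuous fun z => w (x - t • z) := by fun_prop
  have hw2 := hasCompactSupport_comp_sub_smul hw' x ht.ne'
  calc |∫ z, η z * w (x - t • z)| ≤ ∫ z, |η z * w (x - t • z)| := abs_integral_le_integral_abs
    _ = ∫ z, |η z| * |w (x - t • z)| := by simp_rw [abs_mul]
    _ ≤ _ := integral_mul_le_Lp_mul_Lq_of_nonneg hconj (ae_of_all _ fun _ => abs_nonneg _)
        (ae_of_all _ fun _ => abs_nonneg _)
        (hη.memLp_of_hasCompactSupport hη').norm (hw1.memLp_of_hasCompactSupport hw2).norm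
    _ = _ := by
      rw [integral_comp_sub_smul (fun z => |w z| ^ s) x ht,
        Real.mul_rpow (by positivity) (by positivity), mul_assoc, ← Real.rpow_natCast,
        ← Real.rpow_neg ht.le, ← Real.rpow_mul ht.le]
      ring_nf

/-- Derivative in `t` of the average of `u` against the kernel rescaled by `t`. -/
lemma hasDerivAt_integral_radialKernel {n : ℕ} {u : EuclideanSpace ℝ (Fin n) → ℝ}
    (hu : ContDiff ℝ (⊤ : ℕ∞) u)
    (hu' : HasCompactSupport u) (x : EuclideanSpace ℝ (Fin n)) (t : ℝ) :
    HasDerivAt (fun t : ℝ => ∫ z, radialKernel z * u (x - t • z))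
      (∫ z, radialKernel z * fderiv ℝ u (x - t • z) (-z)) t := by
  have hcu := hu.continuous
  have hcd : Continuous (fderiv ℝ u) := hu.continuous_fderiv (by simp)
  have hck := continuous_radialKernel (n := n)
  obtain ⟨M, hM⟩ := (hu'.fderiv ℝ).exists_bound_of_continuous hcd
  refine (hasDerivAt_integral_of_dominated_loc_of_deriv_le (s := univ) univ_mem
    (bound := fun z => radialKernel z * (M * ‖z‖))
    (F' := fun t z => radialKernel z * fderiv ℝ u (x - t • z) (-z))
    (Eventually.of_forall fun t => ?_) ?_ ?_ (ae_of_all _ fun z t _ => ?_) ?_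
    (ae_of_all _ fun z t _ => ?_)).2
  · exact Continuous.aestronglyMeasurable (by fun_prop)
  · exact Continuous.integrable_of_hasCompactSupport (by fun_prop)
      hasCompactSupport_radialKernel.mul_right
  · exact Continuous.aestronglyMeasurable (by fun_prop)
  · rw [norm_mul, Real.norm_of_nonneg (radialKernel_nonneg z)]
    refine mul_le_mul_of_nonneg_left ?_ (radialKernel_nonneg z)
    refine (ContinuousLinearMap.le_opNorm _ _).trans ?_
    rw [norm_neg]
    exact mul_le_mul_of_nonneg_right (hM _) (norm_nonneg _)
  · exact Continuous.integrable_of_hasCompactSupport (by fun_prop)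
      hasCompactSupport_radialKernel.mul_right
  · have h1 : HasDerivAt (fun t : ℝ => x - t • z) (-z) t := by
      simpa using ((hasDerivAt_id t).smul_const z).const_sub x
    exact (((hu.differentiable (by simp)) _).hasFDerivAt.comp_hasDerivAt t h1).const_mul _

lemma integral_radialKernel_mul_fderiv {n : ℕ} {u : EuclideanSpace ℝ (Fin n) → ℝ}
    (hu : ContDiff ℝ (⊤ : ℕ∞) u)
    (x : EuclideanSpace ℝ (Fin n)) (t : ℝ) :
    ∫ z, radialKernel z * fderiv ℝ u (x - t • z) (-z) =
      -(t * ∫ z, radialPotential z * lap u (x - t • z)) := by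
  have hcd : Continuous (fderiv ℝ u) := hu.continuous_fderiv (by simp)
  have hck := continuous_radialKernel (n := n)
  have hcp := continuous_radialPotential (n := n)
  set g : Fin n → EuclideanSpace ℝ (Fin n) → ℝ :=
      fun i y => fderiv ℝ u y (EuclideanSpace.single i 1) with hg
  have hgd : ∀ i, ContDiff ℝ 1 (g i) := fun i =>
    (hu.fderiv_right (m := 1) (by norm_cast)).clm_apply contDiff_const
  have hgc : ∀ i, Continuous (g i) := fun i => (hgd i).continuous
  have hgc' : ∀ i, Continuous (fderiv ℝ (g i)) := fun i => (hgd i).continuous_fderiv (by norm_num)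
  have hder : ∀ i z, HasFDerivAt (fun z => g i (x - t • z))
      ((fderiv ℝ (g i)
          (x - t • z)).comp (-(t • ContinuousLinearMap.id ℝ (EuclideanSpace ℝ (Fin n))))) z := by
    intro i z
    refine (((hgd i).differentiable (by norm_num)) _).hasFDerivAt.comp z ?_
    exact ((hasFDerivAt_id z).const_smul t).const_sub x
  have hder' : ∀ i z, fderiv ℝ (fun z => g i (x - t • z)) z (EuclideanSpace.single i 1) =
      -(t * fderiv ℝ (g i) (x - t • z) (EuclideanSpace.single i 1)) := by
    intro i z
    rw [(hder i z).fderiv]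
    simp
  have hparts : ∀ i, ∫ z, radialKernel z * z i * g i (x - t • z) =
      t * ∫ z, radialPotential z * fderiv ℝ (g i) (x - t • z) (EuclideanSpace.single i 1) := by
    intro i
    have h := integral_mul_fderiv_eq_neg_fderiv_mul_of_integrable (μ := volume)
      (f := radialPotential (n := n)) (g := fun z => g i (x - t • z))
      (v := EuclideanSpace.single i 1) ?_ ?_ ?_
      (fun z _ => (hasFDerivAt_radialPotential z).differentiableAt)
      (fun z _ => (hder i z).differentiableAt)
    · simp only [fderiv_radialPotential_single, hder'] at h
      rw [← neg_eq_iff_eq_neg] at h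
      rw [← h, ← integral_neg, ← integral_const_mul]
      congr 1; ext z; ring
    · simp only [fderiv_radialPotential_single]
      have := hgc i
      exact Continuous.integrable_of_hasCompactSupport (by fun_prop)
        (hasCompactSupport_radialKernel.mul_right.mul_right)
    · simp only [hder']
      have := hgc' i
      exact Continuous.integrable_of_hasCompactSupport (by fun_prop)
        (hasCompactSupport_radialPotential.mul_right)
    · have := hgc i
      exact Continuous.integrable_of_hasCompactSupport (by fun_prop)
        (hasCompactSupport_radialPotential.mul_right)
  have hlhs : ∀ z, radialKernel z * fderiv ℝ u (x - t • z) (-z) =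
      -∑ i, radialKernel z * z i * g i (x - t • z) := by
    intro z
    rw [map_neg, sum_apply_single, mul_neg, Finset.mul_sum]
    simp only [hg, mul_assoc]
  simp_rw [hlhs, lap, Finset.mul_sum]
  rw [integral_neg, integral_finsetSum, integral_finsetSum, Finset.mul_sum]
  · congr 1
    exact Finset.sum_congr rfl fun i _ => hparts i
  · intro i _
    have := hgc' i
    exact Continuous.integrable_of_hasCompactSupport (by fun_prop)
      (hasCompactSupport_radialPotential.mul_right)
  · intro i _
    have := hgc i
    exact Continuous.integrable_of_hasCompactSupport (by fun_prop)
      (hasCompactSupport_radialKernel.mul_right.mul_right)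

/-- Local estimate at scale `ρ`: the average part is controlled by an `L^s` norm of `u` and the
deviation from it by the `L^p` norm of the Laplacian. -/
lemma exists_abs_le_rpow_mul_add {n : ℕ} {p s : ℝ} (hp1 : 1 < p) (hp : (n : ℝ) / 2 < p)
    (hs : 1 < s) :
    ∃ C : ℝ, 0 < C ∧ ∀ u : EuclideanSpace ℝ (Fin n) → ℝ, ContDiff ℝ (⊤ : ℕ∞) u →
        HasCompactSupport u →
      ∀ (x : EuclideanSpace ℝ (Fin n)) (ρ : ℝ), 0 < ρ →
        |u x| ≤ C * (ρ ^ (-(n / s)) * (∫ z, |u z| ^ s) ^ (1 / s) +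
          ρ ^ (2 - n / p) * (∫ z, |lap u z| ^ p) ^ (1 / p)) := by
  have hb : 0 < 2 - n / p := by
    rw [sub_pos, div_lt_iff₀ (by linarith)]; linarith
  set I := ∫ z : EuclideanSpace ℝ (Fin n), radialKernel z with hI
  have hIpos : 0 < I := integral_radialKernel_pos
  set K₁ := (∫ z : EuclideanSpace ℝ (Fin n), |radialKernel z| ^ s.conjExponent) ^ (1 /
      s.conjExponent)
  set K₂ := (∫ z : EuclideanSpace ℝ (Fin n), |radialPotential z| ^ p.conjExponent) ^ (1 /
      p.conjExponent)
  have hK₁0 : 0 ≤ K₁ := by positivity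
  have hK₂0 : 0 ≤ K₂ := by positivity
  refine ⟨(K₁ + K₂ / (2 - n / p) + 1) / I, by positivity, fun u hu hu' x ρ hρ => ?_⟩
  have hlc := continuous_lap hu
  have hls : HasCompactSupport (lap u) :=
    HasCompactSupport.intro hu' fun _ hz => lap_eq_zero_of_notMem_tsupport hz
  set A := (∫ z, |u z| ^ s) ^ (1 / s)
  set B := (∫ z, |lap u z| ^ p) ^ (1 / p)
  have hA0 : 0 ≤ A := by positivity
  have hB0 : 0 ≤ B := by positivity
  set F : ℝ → ℝ := fun t => ∫ z, radialKernel z * u (x - t • z) with hF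
  have hFd : ∀ t, HasDerivAt F (-(t * ∫ z, radialPotential z * lap u (x - t • z))) t := by
    intro t
    rw [← integral_radialKernel_mul_fderiv hu]
    exact hasDerivAt_integral_radialKernel hu hu' x t
  have hF0 : F 0 = I * u x := by
    simp [hF, integral_mul_const, hI]
  have hFρ : |F ρ| ≤ K₁ * ρ ^ (-(n / s)) * A :=
    abs_integral_mul_comp_sub_smul_le continuous_radialKernel hasCompactSupport_radialKernel
      hu.continuous hu' x hρ hs
  have hder : ∀ t, 0 < t → |-(t * ∫ z, radialPotential z * lap u (x - t • z))| ≤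
      K₂ * B * t ^ (1 - n / p) := by
    intro t ht
    rw [abs_neg, abs_mul, abs_of_pos ht]
    refine (mul_le_mul_of_nonneg_left (abs_integral_mul_comp_sub_smul_le continuous_radialPotential
      hasCompactSupport_radialPotential hlc hls x ht hp1) ht.le).trans_eq ?_
    rw [sub_eq_add_neg 1, Real.rpow_add ht, Real.rpow_one]
    ring
  have hG : ∀ t : ℝ, 0 < t → HasDerivAt (fun t : ℝ => K₂ * B / (2 - n / p) * t ^ (2 - n / p))
      (K₂ * B * t ^ (1 - n / p)) t := by
    intro t ht
    have := (Real.hasDerivAt_rpow_const (x := t) (p := 2 - n / p) (Or.inl ht.ne')).const_mul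
      (K₂ * B / (2 - n / p))
    refine this.congr_deriv ?_
    rw [show 2 - n / p - 1 = 1 - n / p by ring, ← mul_assoc, div_mul_cancel₀ _ hb.ne']
  have hGc : Continuous fun t : ℝ => K₂ * B / (2 - n / p) * t ^ (2 - n / p) :=
    continuous_const.mul (Real.continuous_rpow_const hb.le)
  have hFc : Continuous F := continuous_iff_continuousAt.2 fun t => (hFd t).continuousAt
  have hkey : ∀ σ : ℝ, |σ| = 1 → σ * F ρ - K₂ * B / (2 - n / p) * ρ ^ (2 - n / p) ≤ σ * F 0 := by
    intro σ hσ
    have hd : ∀ t, 0 < t → HasDerivAt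
        (fun t => σ * F t - K₂ * B / (2 - n / p) * t ^ (2 - n / p)) _ t :=
      fun t ht => ((hFd t).const_mul σ).sub (hG t ht)
    have hanti : AntitoneOn (fun t => σ * F t - K₂ * B / (2 - n / p) * t ^ (2 - n / p))
        (Ici 0) := by
      refine antitoneOn_of_deriv_nonpos (convex_Ici 0)
        ((continuous_const.mul hFc).sub hGc).continuousOn ?_ ?_
      · rw [interior_Ici]
        exact fun t ht => (hd t ht).differentiableAt.differentiableWithinAt
      · rw [interior_Ici]
        intro t ht
        rw [(hd t ht).deriv, sub_nonpos]
        refine (le_abs_self _).trans ?_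
        rw [abs_mul, hσ, one_mul]
        exact hder t ht
    have := hanti (mem_Ici.2 le_rfl) (mem_Ici.2 hρ.le) hρ.le
    simpa [Real.zero_rpow hb.ne'] using this
  have h1 := hkey 1 (by simp)
  have h2 := hkey (-1) (by simp)
  have hmain : I * |u x| ≤ K₁ * (ρ ^ (-(n / s)) * A) +
      K₂ / (2 - n / p) * (ρ ^ (2 - n / p) * B) := by
    rw [← abs_of_pos hIpos, ← abs_mul, ← hF0]
    have h3 : K₂ * B / (2 - n / p) * ρ ^ (2 - n / p) =
      K₂ / (2 - n / p) * (ρ ^ (2 - n / p) * B) := by ring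
    rw [abs_le] at hFρ
    rw [abs_le]
    constructor <;> linarith
  have hX : 0 ≤ ρ ^ (-(n / s)) * A := by positivity
  have hY : 0 ≤ ρ ^ (2 - n / p) * B := by positivity
  have hK₂' : 0 ≤ K₂ / (2 - n / p) := by positivity
  rw [div_mul_eq_mul_div, le_div_iff₀ hIpos, mul_comm]
  refine hmain.trans ?_
  nlinarith [mul_nonneg hK₁0 hY, mul_nonneg hK₂' hX]

/-- Optimizing the sum of two competing powers over the scale. -/
lemma le_mul_rpow_mul_rpow_of_forall_le {a b C m A B : ℝ} (ha : 0 < a) (hb : 0 < b)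
    (hA : 0 ≤ A) (hB : 0 ≤ B) (hC : 0 < C)
    (h : ∀ ρ : ℝ, 0 < ρ → m ≤ C * (ρ ^ (-a) * A + ρ ^ b * B)) :
    m ≤ 2 * C * A ^ (b / (a + b)) * B ^ (a / (a + b)) := by
  have hpos : ∀ ε : ℝ, 0 < ε →
      m ≤ 2 * C * (A + ε) ^ (b / (a + b)) * (B + ε) ^ (a / (a + b)) := by
    intro ε hε
    have hA' : 0 < A + ε := by linarith
    have hB' : 0 < B + ε := by linarith
    generalize hX : A + ε = X at hA' ⊢
    generalize hY : B + ε = Y at hB' ⊢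
    have hρ : 0 < (X / Y) ^ (1 / (a + b)) := by positivity
    have e1 : ((X / Y) ^ (1 / (a + b))) ^ (-a) * X = X ^ (b / (a + b)) * Y ^ (a / (a + b)) := by
      rw [← Real.rpow_mul (by positivity), Real.div_rpow hA'.le hB'.le,
        show 1 / (a + b) * -a = b / (a + b) - 1 by field_simp; ring, Real.rpow_sub_one hA'.ne',
        show b / (a + b) - 1 = -(a / (a + b)) by field_simp; ring, Real.rpow_neg hB'.le]
      field_simp
    have e2 : ((X / Y) ^ (1 / (a + b))) ^ b * Y = X ^ (b / (a + b)) * Y ^ (a / (a + b)) := by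
      rw [← Real.rpow_mul (by positivity), Real.div_rpow hA'.le hB'.le,
        show 1 / (a + b) * b = b / (a + b) by ring,
        show a / (a + b) = 1 - b / (a + b) by field_simp; ring, Real.rpow_sub hB', Real.rpow_one]
      field_simp
    refine (h _ hρ).trans ?_
    have h1 : C * (((X / Y) ^ (1 / (a + b))) ^ (-a) * A + ((X / Y) ^ (1 / (a + b))) ^ b * B) ≤
        C * (((X / Y) ^ (1 / (a + b))) ^ (-a) * X + ((X / Y) ^ (1 / (a + b))) ^ b * Y) := by
      gcongr <;> linarith
    refine h1.trans_eq ?_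
    rw [e1, e2]
    ring
  have hc : Continuous fun ε : ℝ =>
      2 * C * (A + ε) ^ (b / (a + b)) * (B + ε) ^ (a / (a + b)) := by
    have h1 : 0 ≤ b / (a + b) := by positivity
    have h2 : 0 ≤ a / (a + b) := by positivity
    exact (continuous_const.mul ((Real.continuous_rpow_const h1).comp (by fun_prop))).mul
      ((Real.continuous_rpow_const h2).comp (by fun_prop))
  have hlim := (hc.tendsto 0).mono_left (nhdsWithin_le_nhds (s := Ioi 0))
  simp only [add_zero] at hlim
  exact ge_of_tendsto hlim (by filter_upwards [self_mem_nhdsWithin] with ε hε using hpos ε hε)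

/-- Multiplicative Sobolev inequality (Lemma 3.4 of the paper with `μ = n`,
Euclidean case): with `q = p/(p-1)`, `k = n/((n-2)q) > 1`, `0 ≤ τ₀ < 1/2` and
`α = (1+2τ₀)/(2(1+τ₀)+(k-1)⁻¹) ∈ (0,1)`, there are `C, β > 0` depending only on
`n, p, τ₀` such that for smooth `u` compactly supported in `B(0,r)`,
`‖u‖_∞ ≤ C (ωₙrⁿ)^{-2β/n} ‖u‖_{(1+2τ₀)q}^α (r²‖Δu‖_p + ‖u‖_p)^{1-α}`. -/
theorem multiplicative_sobolev_inequality (n : ℕ) (hn : 3 ≤ n)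
    (p q k τ₀ α : ℝ) (hp : (n:ℝ) / 2 < p)
    (hq : q = p / (p - 1)) (hk : k = (n:ℝ) / (((n:ℝ) - 2) * q))
    (hτ₀ : 0 ≤ τ₀) (hτ₀' : τ₀ < 1/2)
    (hα : α = (1 + 2 * τ₀) / (2 * (1 + τ₀) + (k - 1)⁻¹)) :
    1 < k ∧ α ∈ Set.Ioo (0:ℝ) 1 ∧
    ∃ C : ℝ, 0 < C ∧ ∃ β : ℝ, 0 < β ∧
      ∀ r : ℝ, 0 < r →
        ∀ u : EuclideanSpace ℝ (Fin n) → ℝ,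
          ContDiff ℝ (⊤ : ℕ∞) u → HasCompactSupport u →
          tsupport u ⊆ Metric.ball 0 r →
          ∀ x : EuclideanSpace ℝ (Fin n),
            |u x| ≤ C * ((MeasureTheory.volume
                  (Metric.ball (0 : EuclideanSpace ℝ (Fin n)) 1)).toReal
                * r ^ n) ^ (-(2 * β) / (n:ℝ))
              * ((∫ y in Metric.ball (0 : EuclideanSpace ℝ (Fin n)) r,
                    |u y| ^ ((1 + 2 * τ₀) * q)) ^ (1 / ((1 + 2 * τ₀) * q))) ^ α
              * (r ^ 2 * (∫ y in Metric.ball (0 : EuclideanSpace ℝ (Fin n)) r,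
                      |lap u y| ^ p) ^ (1 / p)
                  + (∫ y in Metric.ball (0 : EuclideanSpace ℝ (Fin n)) r,
                      |u y| ^ p) ^ (1 / p)) ^ (1 - α) := by
  have hn' : (3 : ℝ) ≤ n := by exact_mod_cast hn
  have hp1 : 1 < p := by linarith
  have hp0 : 0 < p - 1 := by linarith
  have hn2 : 0 < (n : ℝ) - 2 := by linarith
  have hq1 : 1 < q := by rw [hq, one_lt_div hp0]; linarith
  have hden : 0 < 2 * p - n := by linarith
  have hk' : k - 1 = (2 * p - n) / ((n - 2) * p) := by
    rw [hk, hq]; field_simp; ring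
  have hk1 : 1 < k := by
    have : 0 < k - 1 := by rw [hk']; positivity
    linarith
  have hs : 1 < (1 + 2 * τ₀) * q := by nlinarith
  set s := (1 + 2 * τ₀) * q with hs_def
  have ha : 0 < n / s := by positivity
  have hb : 0 < 2 - n / p := by
    rw [sub_pos, div_lt_iff₀ (by linarith)]; linarith
  have hα' : α = (2 - n / p) / (n / s + (2 - n / p)) := by
    have hτ : 0 < 1 + 2 * τ₀ := by linarith
    have h2 : 0 < 2 * (1 + τ₀) + (n - 2) * p / (2 * p - n) := by positivity
    have h3 : 0 < n / s + (2 - n / p) := by positivity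
    have hns : n / s = n * (p - 1) / ((1 + 2 * τ₀) * p) := by
      rw [hs_def, hq]; field_simp
    rw [hα, hk', inv_div, div_eq_div_iff h2.ne' h3.ne', hns]
    field_simp
    ring
  have hα1 : 1 - α = n / s / (n / s + (2 - n / p)) := by
    rw [hα', eq_div_iff (by positivity), sub_mul, div_mul_cancel₀ _ (by positivity)]
    ring
  have hα0 : 0 < α := by rw [hα']; positivity
  have hα1' : 0 < 1 - α := by rw [hα1]; positivity
  refine ⟨hk1, ⟨hα0, by linarith⟩, ?_⟩
  obtain ⟨C, hC, hmain⟩ := exists_abs_le_rpow_mul_add (n := n) hp1 hp hs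
  set ω := (volume (ball (0 : EuclideanSpace ℝ (Fin n)) 1)).toReal with hω
  have hω0 : 0 < ω := ENNReal.toReal_pos (measure_ball_pos _ _ one_pos).ne' measure_ball_lt_top.ne
  refine ⟨2 * C * ω ^ (2 * (1 - α) / n), by positivity, 1 - α, hα1', fun r hr u hu hu' hur x => ?_⟩
  have hu0 : ∀ y ∉ ball (0 : EuclideanSpace ℝ (Fin n)) r, u y = 0 := fun y hy =>
    image_eq_zero_of_notMem_tsupport fun h => hy (hur h)
  have hl0 : ∀ y ∉ ball (0 : EuclideanSpace ℝ (Fin n)) r, lap u y = 0 := fun y hy =>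
    lap_eq_zero_of_notMem_tsupport fun h => hy (hur h)
  rw [setIntegral_eq_integral_of_forall_compl_eq_zero (f := fun y => |u y| ^ s)
      fun y hy => by simp [hu0 y hy, Real.zero_rpow (by linarith : s ≠ 0)],
    setIntegral_eq_integral_of_forall_compl_eq_zero (f := fun y => |lap u y| ^ p)
      fun y hy => by simp [hl0 y hy, Real.zero_rpow (by linarith : p ≠ 0)]]
  have hle := le_mul_rpow_mul_rpow_of_forall_le ha hb (by positivity) (by positivity) hC
    (hmain u hu hu' x)
  rw [← hα', ← hα1] at hle
  set A := (∫ z, |u z| ^ s) ^ (1 / s)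
  set B := (∫ z, |lap u z| ^ p) ^ (1 / p)
  set D := (∫ y in ball (0 : EuclideanSpace ℝ (Fin n)) r, |u y| ^ p) ^ (1 / p)
  have hA0 : 0 ≤ A := by positivity
  have hB0 : 0 ≤ B := by positivity
  have hD0 : 0 ≤ D := by positivity
  have hscale : (ω * r ^ n) ^ (-(2 * (1 - α)) / (n : ℝ)) =
      (ω ^ (2 * (1 - α) / n))⁻¹ * ((r ^ 2) ^ (1 - α))⁻¹ := by
    rw [Real.mul_rpow hω0.le (by positivity), neg_div, Real.rpow_neg hω0.le,
      Real.rpow_neg (by positivity), ← Real.rpow_natCast r n, ← Real.rpow_mul hr.le,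
      ← Real.rpow_natCast r 2, ← Real.rpow_mul hr.le]
    congr 3
    push_cast
    field_simp
  calc |u x| ≤ 2 * C * A ^ α * B ^ (1 - α) := hle
    _ = 2 * C * A ^ α * (((r ^ 2) ^ (1 - α))⁻¹ * (r ^ 2 * B) ^ (1 - α)) := by
      rw [Real.mul_rpow (by positivity) hB0]
      field_simp
    _ ≤ 2 * C * A ^ α * (((r ^ 2) ^ (1 - α))⁻¹ * (r ^ 2 * B + D) ^ (1 - α)) := by
      gcongr
      linarith
    _ = _ := by
      rw [hscale]
      field_simp
end
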